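/- Fix η ∈ {i, j, k} and let B₁, C₁ and D₁ be quaternion matrices of conformable sizes with D₁ = D₁^{η*}. Set M := R_{B₁}C₁ and S := C₁L_M, and suppose R_M R_{B₁}D₁ = 0 and R_{B₁}D₁(R_{C₁})^{η*} = 0. Then for any quaternion matrices W₁, U, V of appropriate sizes and any W₂ with W₂ = W₂^{η*}, the matrices Y := B₁†D₁(B₁†)^{η*} − (1/2)B₁†C₁M†D₁[I + (C₁†)^{η*}S^{η*}](B₁†)^{η*} − (1/2)B₁†(I + SC₁†)D₁(M†)^{η*}C₁^{η*}(B₁†)^{η*} − B₁†S W₂ S^{η*}(B₁†)^{η*} + L_{B₁}U + U^{η*}(L_{B₁})^{η*} and Z := (1/2)M†D₁(C₁†)^{η*}[I + (S†S)^{η*}] + (1/2)(I + S†S)C₁†D₁(M†)^{η*} + L_M W₂(L_M)^{η*} + V(L_{C₁})^{η*} + L_{C₁}V^{η*} + L_M L_S W₁ + W₁^{η*}(L_S)^{η*}(L_M)^{η*} are η-Hermitian and satisfy B₁YB₁^{η*} + C₁ZC₁^{η*} = D₁. -/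

import Mathlib

open scoped Quaternion Classical
open Matrix

noncomputable section

/-- The four Moore–Penrose conditions for `X` to be the Moore–Penrose inverse of `A`
over the real quaternions. -/
def IsMP {m n : Type*} [Fintype m] [Fintype n]
    (A : Matrix m n ℍ[ℝ]) (X : Matrix n m ℍ[ℝ]) : Prop :=
  A * X * A = A ∧ X * A * X = X ∧ (A * X)ᴴ = A * X ∧ (X * A)ᴴ = X * A

/-- The Moore–Penrose inverse `A†` of a quaternion matrix (it exists and is unique). -/
def dg {m n : Type*} [Fintype m] [Fintype n]
    (A : Matrix m n ℍ[ℝ]) : Matrix n m ℍ[ℝ] :=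
  if h : ∃ X, IsMP A X then h.choose else 0

/-- `L_A = I - A† A`. -/
def lproj {m n : Type*} [Fintype m] [Fintype n] [DecidableEq n]
    (A : Matrix m n ℍ[ℝ]) : Matrix n n ℍ[ℝ] :=
  1 - dg A * A

/-- `R_A = I - A A†`. -/
def rproj {m n : Type*} [Fintype m] [Fintype n] [DecidableEq m]
    (A : Matrix m n ℍ[ℝ]) : Matrix m m ℍ[ℝ] :=
  1 - A * dg A

/-- `A^{η*} = -η A* η`, entrywise. -/
def etaC (η : ℍ[ℝ]) {m n : Type*} (A : Matrix m n ℍ[ℝ]) : Matrix n m ℍ[ℝ] :=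
  Matrix.of fun i j => -η * star (A j i) * η

/-- `η` is one of the quaternion units `i`, `j`, `k`. -/
def IsImUnit (η : ℍ[ℝ]) : Prop :=
  η = ⟨0, 1, 0, 0⟩ ∨ η = ⟨0, 0, 1, 0⟩ ∨ η = ⟨0, 0, 0, 1⟩

theorem Quaternion.matrix_eq_zero_of_conjTranspose_mul_self_eq_zero {m n : Type*} [Fintype m]
    {A : Matrix m n ℍ[ℝ]} (h : Aᴴ * A = 0) : A = 0 := by
  ext1 i j
  have hj : ∑ k, Quaternion.normSq (A k j) = 0 := by
    have := congrFun (congrFun h j) j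
    simp only [Matrix.mul_apply, Matrix.conjTranspose_apply, Quaternion.star_mul_self,
      Matrix.zero_apply] at this
    apply Quaternion.coe_injective
    exact (map_sum (algebraMap ℝ ℍ[ℝ]) _ _).trans (this.trans Quaternion.coe_zero.symm)
  rw [Finset.sum_eq_zero_iff_of_nonneg fun _ _ => Quaternion.normSq_nonneg] at hj
  simpa using hj i (Finset.mem_univ i)

/-- Matrices over a division ring are von Neumann regular. -/
theorem Matrix.exists_mul_mul_self_eq {m n K : Type*} [Fintype m] [Fintype n] [DivisionRing K]
    (A : Matrix m n K) : ∃ X : Matrix n m K, A * X * A = A := by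
  let f := Matrix.toLinearMapRight' A
  obtain ⟨h, hh⟩ := f.rangeRestrict.exists_rightInverse_of_surjective f.range_rangeRestrict
  obtain ⟨g, hg⟩ := LinearMap.exists_extend h
  refine ⟨LinearMap.toMatrixRight' g, Matrix.toLinearMapRight'.injective ?_⟩
  have hG : Matrix.toLinearMapRight' (LinearMap.toMatrixRight' g) = g :=
    LinearEquiv.symm_apply_apply _ _
  rw [Matrix.toLinearMapRight'_mul, Matrix.toLinearMapRight'_mul, hG]
  refine LinearMap.ext fun x => ?_
  have h₁ := LinearMap.congr_fun hg (f.rangeRestrict x)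
  have h₂ := congrArg Subtype.val (LinearMap.congr_fun hh (f.rangeRestrict x))
  change f (g (f x)) = f x
  change g (f x) = h (f.rangeRestrict x) at h₁
  rw [h₁]
  exact h₂

theorem Quaternion.exists_mul_conjTranspose_mul_self_eq {m n : Type*} [Fintype m] [Fintype n]
    (A : Matrix m n ℍ[ℝ]) :
    ∃ X : Matrix n n ℍ[ℝ], A * X * Aᴴ * A = A ∧ (A * X * Aᴴ)ᴴ = A * X * Aᴴ := by
  obtain ⟨X, hX⟩ := Matrix.exists_mul_mul_self_eq (Aᴴ * A)
  have hE : (A * X * Aᴴ)ᴴ = A * (Xᴴ * Aᴴ) := by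
    simp only [Matrix.conjTranspose_mul, Matrix.mul_assoc, Matrix.conjTranspose_conjTranspose]
  have h₁ : A * X * Aᴴ * A = A := by
    rw [← sub_eq_zero]
    apply Quaternion.matrix_eq_zero_of_conjTranspose_mul_self_eq_zero
    have h₂ : Aᴴ * (A * X * Aᴴ * A - A) = 0 := by
      rw [Matrix.mul_sub, sub_eq_zero]
      simpa only [Matrix.mul_assoc] using hX
    rw [Matrix.conjTranspose_sub, Matrix.conjTranspose_mul, Matrix.sub_mul, h₂,
      hE, Matrix.mul_assoc, Matrix.mul_assoc A, Matrix.mul_assoc Xᴴ, h₂, Matrix.mul_zero,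
      Matrix.mul_zero, Matrix.mul_zero, sub_zero]
  refine ⟨X, h₁, ?_⟩
  have h₃ : (A * X * Aᴴ)ᴴ = A * X * Aᴴ * (A * X * Aᴴ)ᴴ := by
    rw [hE, ← Matrix.mul_assoc (A * X * Aᴴ), h₁]
  have h₄ := congrArg Matrix.conjTranspose h₃
  rw [Matrix.conjTranspose_mul (A * X * Aᴴ), Matrix.conjTranspose_conjTranspose, ← h₃] at h₄
  exact h₄.symm

theorem Quaternion.matrix_exists_isMP {m n : Type*} [Fintype m] [Fintype n]
    (A : Matrix m n ℍ[ℝ]) : ∃ X, IsMP A X := by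
  obtain ⟨X, h₁, h₂⟩ := Quaternion.exists_mul_conjTranspose_mul_self_eq A
  obtain ⟨Y, h₃, h₄⟩ := Quaternion.exists_mul_conjTranspose_mul_self_eq Aᴴ
  rw [Matrix.conjTranspose_conjTranspose] at h₃ h₄
  have h₅ : A * (Aᴴ * Y * A) = A := by
    have := congrArg Matrix.conjTranspose h₃
    rwa [Matrix.conjTranspose_mul, h₄, Matrix.conjTranspose_conjTranspose] at this
  have h₆ : A * (Aᴴ * Y * A * X * Aᴴ) = A * X * Aᴴ := by
    calc _ = A * (Aᴴ * Y * A) * X * Aᴴ := by simp only [Matrix.mul_assoc]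
      _ = _ := by rw [h₅]
  have h₇ : Aᴴ * Y * A * X * Aᴴ * A = Aᴴ * Y * A := by
    calc _ = Aᴴ * Y * (A * X * Aᴴ * A) := by simp only [Matrix.mul_assoc]
      _ = _ := by rw [h₁]
  refine ⟨Aᴴ * Y * A * X * Aᴴ, ?_, ?_, ?_, ?_⟩
  · rw [h₆, h₁]
  · rw [h₇]
    calc _ = Aᴴ * Y * (A * (Aᴴ * Y * A)) * X * Aᴴ := by simp only [Matrix.mul_assoc]
      _ = _ := by rw [h₅]
  · rw [h₆, h₂]
  · rw [h₇, h₄]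

theorem isMP_dg {m n : Type*} [Fintype m] [Fintype n] (A : Matrix m n ℍ[ℝ]) :
    IsMP A (dg A) := by
  have h := Quaternion.matrix_exists_isMP A
  rw [dg, dif_pos h]
  exact h.choose_spec

section etaC

variable {η : ℍ[ℝ]} {l m n : Type*}

theorem IsImUnit.coordinates (hη : IsImUnit η) :
    η.re = 0 ∧ (η.imI = 1 ∧ η.imJ = 0 ∧ η.imK = 0 ∨ η.imI = 0 ∧ η.imJ = 1 ∧ η.imK = 0 ∨
      η.imI = 0 ∧ η.imJ = 0 ∧ η.imK = 1) := by
  rcases hη with rfl | rfl | rfl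
  · exact ⟨rfl, Or.inl ⟨rfl, rfl, rfl⟩⟩
  · exact ⟨rfl, Or.inr (Or.inl ⟨rfl, rfl, rfl⟩)⟩
  · exact ⟨rfl, Or.inr (Or.inr ⟨rfl, rfl, rfl⟩)⟩

theorem IsImUnit.mul_self (hη : IsImUnit η) : η * η = -1 := by
  obtain ⟨hr, ⟨hi, hj, hk⟩ | ⟨hi, hj, hk⟩ | ⟨hi, hj, hk⟩⟩ := hη.coordinates <;>
    apply Quaternion.ext <;> simp [hr, hi, hj, hk]

theorem IsImUnit.star_eq (hη : IsImUnit η) : star η = -η := by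
  apply Quaternion.ext <;> simp [hη.coordinates.1]

theorem etaC_etaC (hη : IsImUnit η) (A : Matrix m n ℍ[ℝ]) : etaC η (etaC η A) = A := by
  ext1 i j
  simp only [etaC, Matrix.of_apply, star_mul, star_neg, star_star, hη.star_eq, neg_neg]
  calc _ = (η * η) * A i j * (η * η) := by noncomm_ring
    _ = _ := by simp [hη.mul_self]

theorem etaC_add (A B : Matrix m n ℍ[ℝ]) : etaC η (A + B) = etaC η A + etaC η B := by
  ext1 i j
  simp only [etaC, Matrix.of_apply, Matrix.add_apply, star_add, mul_add, add_mul]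

theorem etaC_sub (A B : Matrix m n ℍ[ℝ]) : etaC η (A - B) = etaC η A - etaC η B := by
  ext1 i j
  simp only [etaC, Matrix.of_apply, Matrix.sub_apply, star_sub, mul_sub, sub_mul]

theorem etaC_smul (r : ℝ) (A : Matrix m n ℍ[ℝ]) : etaC η (r • A) = r • etaC η A := by
  ext1 i j
  simp only [etaC, Matrix.of_apply, Matrix.smul_apply, Quaternion.star_smul, mul_smul_comm,
    smul_mul_assoc]

theorem etaC_zero : etaC η (0 : Matrix m n ℍ[ℝ]) = 0 := by
  ext1 i j
  simp only [etaC, Matrix.of_apply, Matrix.zero_apply, star_zero, mul_zero, zero_mul]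

theorem etaC_one [DecidableEq n] (hη : IsImUnit η) : etaC η (1 : Matrix n n ℍ[ℝ]) = 1 := by
  ext1 i j
  rcases eq_or_ne i j with rfl | h
  · simp [etaC, hη.mul_self]
  · simp [etaC, h, h.symm]

theorem etaC_mul [Fintype m] (hη : IsImUnit η) (A : Matrix l m ℍ[ℝ]) (B : Matrix m n ℍ[ℝ]) :
    etaC η (A * B) = etaC η B * etaC η A := by
  ext1 i j
  simp only [etaC, Matrix.of_apply, Matrix.mul_apply, star_sum, Finset.mul_sum, Finset.sum_mul]
  refine Finset.sum_congr rfl fun k _ => ?_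
  calc _ = -η * star (B k i) * -(-1) * star (A j k) * η := by rw [star_mul]; noncomm_ring
    _ = _ := by rw [← hη.mul_self]; noncomm_ring

end etaC

section Projections

variable {m n : Type*} [Fintype m] [Fintype n]

theorem mul_lproj [DecidableEq n] (A : Matrix m n ℍ[ℝ]) : A * lproj A = 0 := by
  rw [lproj, Matrix.mul_sub, Matrix.mul_one, ← Matrix.mul_assoc, (isMP_dg A).1, sub_self]

theorem rproj_mul [DecidableEq m] (A : Matrix m n ℍ[ℝ]) : rproj A * A = 0 := by
  rw [rproj, Matrix.sub_mul, Matrix.one_mul, (isMP_dg A).1, sub_self]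

theorem conjTranspose_lproj [DecidableEq n] (A : Matrix m n ℍ[ℝ]) : (lproj A)ᴴ = lproj A := by
  rw [lproj, Matrix.conjTranspose_sub, Matrix.conjTranspose_one, (isMP_dg A).2.2.2]

theorem conjTranspose_rproj [DecidableEq m] (A : Matrix m n ℍ[ℝ]) : (rproj A)ᴴ = rproj A := by
  rw [rproj, Matrix.conjTranspose_sub, Matrix.conjTranspose_one, (isMP_dg A).2.2.1]

theorem lproj_mul_lproj [DecidableEq n] (A : Matrix m n ℍ[ℝ]) :
    lproj A * lproj A = lproj A := by
  conv_lhs => enter [1]; rw [lproj]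
  rw [Matrix.sub_mul, Matrix.one_mul, Matrix.mul_assoc, mul_lproj, Matrix.mul_zero, sub_zero]

theorem rproj_mul_rproj [DecidableEq m] (A : Matrix m n ℍ[ℝ]) :
    rproj A * rproj A = rproj A := by
  conv_lhs => enter [2]; rw [rproj]
  rw [Matrix.mul_sub, Matrix.mul_one, ← Matrix.mul_assoc, rproj_mul, Matrix.zero_mul, sub_zero]

theorem dg_mul_eq_self {A : Matrix m n ℍ[ℝ]} {E : Matrix m m ℍ[ℝ]} (hE : Eᴴ = E)
    (h : E * A = A) : dg A * E = dg A := by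
  have h₁ : A * dg A * E = A * dg A := by
    have := congrArg Matrix.conjTranspose (show E * (A * dg A) = A * dg A by
      rw [← Matrix.mul_assoc, h])
    rwa [Matrix.conjTranspose_mul, (isMP_dg A).2.2.1, hE] at this
  calc dg A * E = dg A * A * dg A * E := by rw [(isMP_dg A).2.1]
    _ = dg A * (A * dg A * E) := by simp only [Matrix.mul_assoc]
    _ = dg A := by rw [h₁, ← Matrix.mul_assoc, (isMP_dg A).2.1]

theorem mul_dg_mul_self_of_mul_eq {A : Matrix m n ℍ[ℝ]} {E : Matrix n n ℍ[ℝ]} (hE : Eᴴ = E)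
    (h : A * E = A) : E * (dg A * A) = dg A * A := by
  have := congrArg Matrix.conjTranspose (show dg A * A * E = dg A * A by
      rw [Matrix.mul_assoc, h])
  rwa [Matrix.conjTranspose_mul, (isMP_dg A).2.2.2, hE] at this

end Projections

theorem pair_equation_ring_identity {R : Type*} [Ring R] {D P P' N N' Q Q' K K' : R}
    (h₁ : (1 - P) * D = (1 - P) * N * D) (h₁' : D * (1 - P') = D * N' * (1 - P'))
    (h₂ : (1 - P) * D * Q' = (1 - P) * D) (h₂' : Q * D * (1 - P') = D * (1 - P'))
    (hN : N * (1 - P) = N) (hN' : (1 - P') * N' = N')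
    (hK : K = Q - N * Q) (hK' : K' = Q' - Q' * N') (hPK : P * K = K) (hPK' : K' * P' = K') :
    (P * D * P' + P * D * P') - P * N * D * (1 + K') * P' - P * (1 + K) * D * N' * P'
      + N * D * (Q' + K') + (Q + K) * D * N' = D + D := by
  have e₁ : N * D * Q' = N * D := by
    calc _ = N * ((1 - P) * D * Q') := by conv_lhs => rw [← hN]
                                          noncomm_ring
      _ = N * (1 - P) * D := by rw [h₂]; noncomm_ring
      _ = _ := by rw [hN]
  have e₁' : Q * D * N' = D * N' := by
    calc _ = (Q * D * (1 - P')) * N' := by conv_lhs => rw [← hN']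
                                           noncomm_ring
      _ = D * ((1 - P') * N') := by rw [h₂']; noncomm_ring
      _ = _ := by rw [hN']
  have e₂ : (1 - P) * N * D * K' = (1 - P) * D - (1 - P) * D * N' := by
    rw [← h₁, hK', mul_sub, ← mul_assoc, h₂]
  have e₂' : K * (D * N' * (1 - P')) = D * (1 - P') - N * D * (1 - P') := by
    rw [← h₁', hK, sub_mul, ← mul_assoc, h₂', mul_assoc N, ← mul_assoc Q, h₂', mul_assoc N]
  have e₃ : P * N * D * (1 + K') * P' = P * N * D * P' + P * N * D * K' := by
    rw [mul_assoc (P * N * D), add_mul, hPK', one_mul, mul_add]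
  have e₄ : P * (1 + K) * D * N' * P' = P * D * N' * P' + K * D * N' * P' := by
    rw [mul_add, hPK]; noncomm_ring
  rw [e₃, e₄, mul_add, add_mul, add_mul, e₁, e₁']
  have f₁ : N * D * K' = P * N * D * K' + ((1 - P) * D - (1 - P) * D * N') := by
    rw [← e₂]; noncomm_ring
  have f₂ : K * D * N' = K * D * N' * P' + (D * (1 - P') - N * D * (1 - P')) := by
    rw [← e₂']; noncomm_ring
  have g₁ : (1 - P) * D * P' = (1 - P) * N * D * P' := by rw [h₁]
  have g₂ : P * D * (1 - P') = P * D * N' * (1 - P') := by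
    rw [mul_assoc, h₁']; noncomm_ring
  linear_combination (norm := noncomm_ring) f₁ + f₂ - g₁ - g₂

/-- Under the solvability conditions, the displayed matrices `Y`, `Z`
are η-Hermitian solutions of `B₁YB₁^{η*} + C₁ZC₁^{η*} = D₁`. -/
theorem quat_etaHermitian_pair_equation_solution_formula
    {p m n : ℕ} (η : ℍ[ℝ]) (hη : IsImUnit η)
    (B₁ : Matrix (Fin p) (Fin m) ℍ[ℝ]) (C₁ : Matrix (Fin p) (Fin n) ℍ[ℝ])
    (D₁ : Matrix (Fin p) (Fin p) ℍ[ℝ]) (hD₁ : D₁ = etaC η D₁) :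
    let M := rproj B₁ * C₁
    let S := C₁ * lproj M
    rproj M * rproj B₁ * D₁ = 0 →
    rproj B₁ * D₁ * etaC η (rproj C₁) = 0 →
    ∀ (W₁ : Matrix (Fin n) (Fin n) ℍ[ℝ]) (U : Matrix (Fin m) (Fin m) ℍ[ℝ])
      (V : Matrix (Fin n) (Fin n) ℍ[ℝ]) (W₂ : Matrix (Fin n) (Fin n) ℍ[ℝ]),
      W₂ = etaC η W₂ →
      let Y := dg B₁ * D₁ * etaC η (dg B₁)
          - (2 : ℝ)⁻¹ • (dg B₁ * C₁ * dg M * D₁ * (1 + etaC η (dg C₁) * etaC η S)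
              * etaC η (dg B₁))
          - (2 : ℝ)⁻¹ • (dg B₁ * (1 + S * dg C₁) * D₁ * etaC η (dg M) * etaC η C₁
              * etaC η (dg B₁))
          - dg B₁ * S * W₂ * etaC η S * etaC η (dg B₁)
          + lproj B₁ * U + etaC η U * etaC η (lproj B₁)
      let Z := (2 : ℝ)⁻¹ • (dg M * D₁ * etaC η (dg C₁) * (1 + etaC η (dg S * S)))
          + (2 : ℝ)⁻¹ • ((1 + dg S * S) * dg C₁ * D₁ * etaC η (dg M))
          + lproj M * W₂ * etaC η (lproj M) + V * etaC η (lproj C₁) + lproj C₁ * etaC η V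
          + lproj M * lproj S * W₁ + etaC η W₁ * etaC η (lproj S) * etaC η (lproj M)
      Y = etaC η Y ∧ Z = etaC η Z ∧ B₁ * Y * etaC η B₁ + C₁ * Z * etaC η C₁ = D₁ := by
  intro M S hM hC W₁ U V W₂ hW₂ Y Z
  have hMR : dg M * rproj B₁ = dg M :=
    dg_mul_eq_self (conjTranspose_rproj B₁) (by
      rw [← Matrix.mul_assoc, rproj_mul_rproj])
  have hRS : rproj B₁ * S = 0 := by rw [← Matrix.mul_assoc, mul_lproj M]
  have hPS : B₁ * dg B₁ * S = S := by
    rw [rproj, Matrix.sub_mul, Matrix.one_mul, sub_eq_zero] at hRS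
    exact hRS.symm
  have hCS : C₁ * (dg S * S) = S := by
    have h : lproj M * (dg S * S) = dg S * S :=
      mul_dg_mul_self_of_mul_eq (conjTranspose_lproj M) (by
        rw [Matrix.mul_assoc, lproj_mul_lproj])
    rw [← h, ← Matrix.mul_assoc, ← Matrix.mul_assoc, (isMP_dg S).1]
  have hSL : C₁ * lproj M * lproj S = 0 := mul_lproj S
  have h₁ : (1 - B₁ * dg B₁) * D₁ = (1 - B₁ * dg B₁) * (C₁ * dg M) * D₁ := by
    rw [Matrix.mul_assoc, rproj, Matrix.sub_mul, Matrix.one_mul, sub_eq_zero,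
      Matrix.mul_assoc M, ← Matrix.mul_assoc (dg M), hMR] at hM
    rw [← Matrix.mul_assoc (1 - B₁ * dg B₁) C₁]
    exact hM.trans (Matrix.mul_assoc _ _ _).symm
  have h₂ : (1 - B₁ * dg B₁) * D₁ * etaC η (C₁ * dg C₁) = (1 - B₁ * dg B₁) * D₁ := by
    rw [rproj, rproj, etaC_sub, etaC_one hη, Matrix.mul_sub, Matrix.mul_one, sub_eq_zero] at hC
    exact hC.symm
  have hN : C₁ * dg M * (1 - B₁ * dg B₁) = C₁ * dg M := by
    rw [Matrix.mul_assoc]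
    exact congrArg (C₁ * ·) hMR
  have hK : S * dg C₁ = C₁ * dg C₁ - C₁ * dg M * (C₁ * dg C₁) := by
    have h : dg M * M = dg M * C₁ := by
      change dg M * (rproj B₁ * C₁) = _
      rw [← Matrix.mul_assoc, hMR]
    change C₁ * (1 - dg M * M) * dg C₁ = _
    rw [h, Matrix.mul_sub, Matrix.sub_mul, Matrix.mul_one]
    simp only [Matrix.mul_assoc]
  have hPK : B₁ * dg B₁ * (S * dg C₁) = S * dg C₁ := by rw [← Matrix.mul_assoc, hPS]
  have h₁' := congrArg (etaC η) h₁
  have h₂' := congrArg (etaC η) h₂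
  have hN' := congrArg (etaC η) hN
  have hK' := congrArg (etaC η) hK
  have hPK' := congrArg (etaC η) hPK
  rw [etaC_mul hη, etaC_mul hη _ D₁, etaC_mul hη _ (C₁ * dg M), etaC_sub, etaC_one hη, ← hD₁,
    ← Matrix.mul_assoc] at h₁'
  rw [etaC_mul hη, etaC_mul hη _ D₁, etaC_sub, etaC_one hη, ← hD₁, etaC_etaC hη,
    ← Matrix.mul_assoc] at h₂'
  rw [etaC_mul hη, etaC_sub, etaC_one hη] at hN'
  rw [etaC_sub, etaC_mul hη (C₁ * dg M)] at hK'
  rw [etaC_mul hη (B₁ * dg B₁)] at hPK'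
  have key := pair_equation_ring_identity h₁ h₁' h₂ h₂' hN hN' hK hK' hPK hPK'
  have hD : D₁ = (2 : ℝ)⁻¹ • (D₁ + D₁) := by
    rw [← two_smul ℝ D₁, smul_smul, inv_mul_cancel₀ two_ne_zero, one_smul]
  have hBL : etaC η (lproj B₁) * etaC η B₁ = 0 := by
    rw [← etaC_mul hη, mul_lproj, etaC_zero]
  have hCL : etaC η (lproj C₁) * etaC η C₁ = 0 := by
    rw [← etaC_mul hη, mul_lproj, etaC_zero]
  refine ⟨?_, ?_, ?_⟩
  · simp only [Y, etaC_add, etaC_sub, etaC_smul, etaC_mul hη, etaC_one hη, etaC_etaC hη, ← hD₁,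
      ← hW₂, Matrix.mul_assoc]
    abel
  · simp only [Z, etaC_add, etaC_smul, etaC_mul hη, etaC_one hη, etaC_etaC hη, ← hD₁,
      ← hW₂, Matrix.mul_assoc]
    abel
  · have hY : B₁ * Y * etaC η B₁ = B₁ * dg B₁ * D₁ * etaC η (B₁ * dg B₁)
        - (2 : ℝ)⁻¹ • (B₁ * dg B₁ * (C₁ * dg M) * D₁ * (1 + etaC η (S * dg C₁))
          * etaC η (B₁ * dg B₁))
        - (2 : ℝ)⁻¹ • (B₁ * dg B₁ * (1 + S * dg C₁) * D₁ * etaC η (C₁ * dg M)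
          * etaC η (B₁ * dg B₁))
        - (B₁ * dg B₁ * S) * W₂ * etaC η (B₁ * dg B₁ * S)
        + B₁ * lproj B₁ * U * etaC η B₁ + B₁ * etaC η U * (etaC η (lproj B₁) * etaC η B₁) := by
      simp only [Y, etaC_mul hη, Matrix.mul_add, Matrix.add_mul, Matrix.mul_sub, Matrix.sub_mul,
        Matrix.mul_smul, Matrix.smul_mul, Matrix.mul_assoc]
    have hZ : C₁ * Z * etaC η C₁ =
        (2 : ℝ)⁻¹ • (C₁ * dg M * D₁ * (etaC η (C₁ * dg C₁)
          + etaC η (C₁ * (dg S * S) * dg C₁)))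
        + (2 : ℝ)⁻¹ • ((C₁ * dg C₁ + C₁ * (dg S * S) * dg C₁) * D₁ * etaC η (C₁ * dg M))
        + (C₁ * lproj M) * W₂ * etaC η (C₁ * lproj M) + C₁ * V * (etaC η (lproj C₁) * etaC η C₁)
        + C₁ * lproj C₁ * etaC η V * etaC η C₁
        + C₁ * lproj M * lproj S * W₁ * etaC η C₁
        + C₁ * etaC η W₁ * etaC η (C₁ * lproj M * lproj S) := by
      simp only [Z, etaC_mul hη, Matrix.mul_add, Matrix.add_mul,
        Matrix.mul_smul, Matrix.smul_mul, Matrix.mul_assoc, Matrix.mul_one, Matrix.one_mul]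
    rw [hPS, mul_lproj, hBL] at hY
    rw [hCS, mul_lproj, hCL, hSL, etaC_zero] at hZ
    change C₁ * Z * etaC η C₁ = _ + S * W₂ * etaC η S + _ + _ + _ + _ at hZ
    rw [hY, hZ]
    conv_rhs => rw [hD, ← key]
    simp only [Matrix.zero_mul, Matrix.mul_zero]
    module
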